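/- In 𝒪_q(Mat_{2n}) with x_{ij} := Σ_{k=1}^{n} (t_{i,2k−1} t_{j,2k} − q t_{i,2k} t_{j,2k−1}), the following relations hold: x_{lh}x_{dk} = q⁻¹x_{dk}x_{lh} if d=l<k<h; x_{lh}x_{dk} = q⁻¹x_{dk}x_{lh} if d<l<k=h; x_{lh}x_{dk} = q⁻¹x_{dk}x_{lh} if d<l=k<h; x_{lh}x_{dk} = x_{dk}x_{lh} − (q−q⁻¹)x_{dh}x_{lk} if d<l<k<h; x_{lh}x_{dk} = x_{dk}x_{lh} + (q−q⁻¹)(q·x_{dh}x_{kl} − x_{dl}x_{kh}) if d<k<l<h; and x_{lh}x_{dk} = x_{dk}x_{lh} if d<l<h<k. -/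

import Mathlib

open scoped BigOperators TensorProduct

noncomputable section

abbrev K : Type := RatFunc ℂ

def q : K := RatFunc.X

/-- the generator `t_{ij}` of the free algebra -/
def Tg {n : ℕ} (i j : Fin n) : FreeAlgebra K (Fin n × Fin n) := FreeAlgebra.ι K (i, j)

/-- defining relations of `𝒪_q(Mat_n)` -/
inductive matRel (n : ℕ) :
    FreeAlgebra K (Fin n × Fin n) → FreeAlgebra K (Fin n × Fin n) → Prop
  | rowq (l i j : Fin n) (h : i < j) :
      matRel n (Tg l i * Tg l j) (q • (Tg l j * Tg l i))
  | colq (l i j : Fin n) (h : i < j) :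
      matRel n (Tg i l * Tg j l) (q • (Tg j l * Tg i l))
  | anti (i k j l : Fin n) (h1 : i < k) (h2 : j < l) :
      matRel n (Tg i l * Tg k j) (Tg k j * Tg i l)
  | main (i k j l : Fin n) (h1 : i < k) (h2 : j < l) :
      matRel n (Tg i j * Tg k l) (Tg k l * Tg i j + (q - q⁻¹) • (Tg k j * Tg i l))

/-- the quantized function algebra `𝒪_q(Mat_n)` -/
abbrev OqMat (n : ℕ) := RingQuot (matRel n)

/-- the generator `t_{ij}` of `𝒪_q(Mat_n)` -/
def tGen {n : ℕ} (i j : Fin n) : OqMat n :=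
  RingQuot.mkAlgHom K (matRel n) (Tg i j)

/-- the odd column index `2k-1` (1-based), i.e. `2k` (0-based) -/
def c1 (n : ℕ) (k : Fin n) : Fin (2 * n) := ⟨2 * (k : ℕ), by have := k.isLt; omega⟩

/-- the even column index `2k` (1-based), i.e. `2k+1` (0-based) -/
def c2 (n : ℕ) (k : Fin n) : Fin (2 * n) := ⟨2 * (k : ℕ) + 1, by have := k.isLt; omega⟩

/-- the Type AII quantum skew-symmetric matrix generators -/
def xAII (n : ℕ) (i j : Fin (2 * n)) : OqMat (2 * n) :=
  ∑ k : Fin n, (tGen i (c1 n k) * tGen j (c2 n k) - q • (tGen i (c2 n k) * tGen j (c1 n k)))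

/-- A family `t` with rows in `ι` and columns in `κ` satisfying the quantum matrix relations with
parameter `v`, written as rules that sort columns first and rows within a column second.
The scalar `1` in `anti` keeps `simp` from treating it as a permutation lemma. -/
structure QuantumRelations {ι κ F A : Type*} [LT ι] [LT κ] [Field F] [Ring A]
    [Algebra F A] (v : F) (t : ι → κ → A) : Prop where
  row : ∀ k {j l}, j < l → t k l * t k j = v⁻¹ • (t k j * t k l)
  col : ∀ l {i k}, i < k → t k l * t i l = v⁻¹ • (t i l * t k l)
  anti : ∀ {i k j l}, i < k → j < l → t i l * t k j = (1 : F) • (t k j * t i l)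
  main : ∀ {i k j l}, i < k → j < l →
    t k l * t i j = t i j * t k l - (v - v⁻¹) • (t k j * t i l)

lemma q_ne_zero : q ≠ 0 := RatFunc.X_ne_zero

lemma tGen_quantumRelations (n : ℕ) : QuantumRelations q (tGen (n := n)) where
  row k j l h := by
    have := RingQuot.mkAlgHom_rel K (matRel.rowq k j l h)
    simp only [map_mul, map_smul] at this
    simp only [tGen, this, smul_smul, inv_mul_cancel₀ q_ne_zero, one_smul]
  col l i k h := by
    have := RingQuot.mkAlgHom_rel K (matRel.colq l i k h)
    simp only [map_mul, map_smul] at this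
    simp only [tGen, this, smul_smul, inv_mul_cancel₀ q_ne_zero, one_smul]
  anti h1 h2 := by
    have := RingQuot.mkAlgHom_rel K (matRel.anti _ _ _ _ h1 h2)
    simp only [map_mul] at this
    simp only [tGen, this, one_smul]
  main h1 h2 := by
    have := RingQuot.mkAlgHom_rel K (matRel.main _ _ _ _ h1 h2)
    simp only [map_mul, map_smul, map_add] at this
    simp only [tGen, this, add_sub_cancel_right]

lemma sum_sum_eq_zero {A : Type*} [AddCommGroup A] :
    ∀ {n : ℕ} (f : Fin n → Fin n → A), (∀ p, f p p = 0) →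
      (∀ p r, p < r → f p r + f r p = 0) → ∑ p, ∑ r, f p r = 0
  | 0, _, _, _ => by simp
  | n + 1, f, hdiag, hcross => by
    have ih := sum_sum_eq_zero (fun p r : Fin n => f p.succ r.succ) (fun p => hdiag p.succ)
      fun p r h => hcross p.succ r.succ (Fin.succ_lt_succ_iff.2 h)
    have h0 : ∑ r : Fin n, (f 0 r.succ + f r.succ 0) = 0 :=
      Finset.sum_eq_zero fun r _ => hcross 0 r.succ (Fin.succ_pos r)
    simp only [Fin.sum_univ_succ, Finset.sum_add_distrib, hdiag, zero_add, ih, add_zero] at h0 ⊢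
    rw [add_comm, h0]

namespace QuantumRelations

variable {ι κ F A : Type*} [Preorder ι] [Preorder κ] [Field F] [Ring A] [Algebra F A]
  {v : F} {t : ι → κ → A}

lemma row_assoc (ht : QuantumRelations v t) (k : ι) {j l : κ} (h : j < l) (z : A) :
    t k l * (t k j * z) = v⁻¹ • (t k j * (t k l * z)) := by
  simp only [← mul_assoc, ht.row k h, smul_mul_assoc]

lemma col_assoc (ht : QuantumRelations v t) (l : κ) {i k : ι} (h : i < k) (z : A) :
    t k l * (t i l * z) = v⁻¹ • (t i l * (t k l * z)) := by
  simp only [← mul_assoc, ht.col l h, smul_mul_assoc]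

lemma anti_assoc (ht : QuantumRelations v t) {i k : ι} {j l : κ} (h1 : i < k) (h2 : j < l)
    (z : A) : t i l * (t k j * z) = (1 : F) • (t k j * (t i l * z)) := by
  simp only [← mul_assoc, ht.anti h1 h2, smul_mul_assoc]

lemma main_assoc (ht : QuantumRelations v t) {i k : ι} {j l : κ} (h1 : i < k) (h2 : j < l)
    (z : A) :
    t k l * (t i j * z) = t i j * (t k l * z) - (v - v⁻¹) • (t k j * (t i l * z)) := by
  simp only [← mul_assoc, ht.main h1 h2, sub_mul, smul_mul_assoc]

set_option maxHeartbeats 2000000 in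
/-- The relations between the quantum skew forms of rows `i` and `j`, summed over pairs of columns
`a p < b p` such that different pairs do not interlace. -/
theorem skewForm_relations (ht : QuantumRelations v t) (hv : v ≠ 0) {n : ℕ} {a b : Fin n → κ}
    (hab : ∀ p, a p < b p) (hsep : ∀ p r, p < r → b p < a r) {x : ι → ι → A}
    (hx : ∀ i j, x i j = ∑ p, (t i (a p) * t j (b p) - v • (t i (b p) * t j (a p))))
    (l h d k : ι) :
    (d = l → l < k → k < h →
      x l h * x d k = v⁻¹ • (x d k * x l h)) ∧
    (d < l → l < k → k = h →
      x l h * x d k = v⁻¹ • (x d k * x l h)) ∧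
    (d < l → l = k → k < h →
      x l h * x d k = v⁻¹ • (x d k * x l h)) ∧
    (d < l → l < k → k < h →
      x l h * x d k =
        x d k * x l h - (v - v⁻¹) • (x d h * x l k)) ∧
    (d < k → k < l → l < h →
      x l h * x d k =
        x d k * x l h +
          (v - v⁻¹) • (v • (x d h * x k l) - x d l * x k h)) ∧
    (d < l → l < h → h < k →
      x l h * x d k = x d k * x l h) := by
  refine ⟨?_, ?_, ?_, ?_, ?_, ?_⟩
  on_goal 1 => rintro rfl h1 h2
  on_goal 2 => rintro h1 h2 rfl
  on_goal 3 => rintro h1 rfl h2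
  on_goal 4 => rintro h1 h2 h3; have h4 := h2.trans h3; have h5 := h1.trans h4
  on_goal 5 => rintro h1 h2 h3; have h4 := h2.trans h3; have h5 := h1.trans h4
  on_goal 6 => rintro h1 h2 h3; have h4 := h2.trans h3; have h5 := h1.trans h4
  all_goals
    have h12 := h1.trans h2
    rw [← sub_eq_zero]
    simp only [hx, Finset.sum_mul_sum, Finset.smul_sum, ← Finset.sum_sub_distrib,
      ← Finset.sum_add_distrib]
    refine sum_sum_eq_zero _ (fun p => ?_) (fun p r hpr => ?_)
    on_goal 1 => have hp := hab p
    on_goal 2 =>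
      have hp := hab p
      have hr := hab r
      have h_ba := hsep p r hpr
      have h_aa := hp.trans h_ba
      have h_bb := h_ba.trans hr
      have h_ab := hp.trans h_bb
    all_goals
      clear hx hab hsep
      simp only [mul_sub, sub_mul, mul_assoc, smul_mul_assoc, mul_smul_comm, smul_sub,
        smul_smul, ht.row, ht.col, ht.anti, ht.main, ht.row_assoc, ht.col_assoc, ht.anti_assoc,
        ht.main_assoc, *]
      match_scalars <;> field_simp <;> ring

end QuantumRelations

theorem stmt9 (n : ℕ) (l h d kk : Fin (2 * n)) :
    (d = l → l < kk → kk < h →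
      xAII n l h * xAII n d kk = q⁻¹ • (xAII n d kk * xAII n l h)) ∧
    (d < l → l < kk → kk = h →
      xAII n l h * xAII n d kk = q⁻¹ • (xAII n d kk * xAII n l h)) ∧
    (d < l → l = kk → kk < h →
      xAII n l h * xAII n d kk = q⁻¹ • (xAII n d kk * xAII n l h)) ∧
    (d < l → l < kk → kk < h →
      xAII n l h * xAII n d kk =
        xAII n d kk * xAII n l h - (q - q⁻¹) • (xAII n d h * xAII n l kk)) ∧
    (d < kk → kk < l → l < h →
      xAII n l h * xAII n d kk =
        xAII n d kk * xAII n l h +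
          (q - q⁻¹) • (q • (xAII n d h * xAII n kk l) - xAII n d l * xAII n kk h)) ∧
    (d < l → l < h → h < kk →
      xAII n l h * xAII n d kk = xAII n d kk * xAII n l h) := by
  exact (tGen_quantumRelations (2 * n)).skewForm_relations q_ne_zero (a := c1 n) (b := c2 n)
    (fun p => by simp [c1, c2, Fin.lt_def])
    (fun p r h => by simp only [c1, c2, Fin.lt_def] at h ⊢; omega)
    (fun _ _ => rfl) l h d kk
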